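/- Let (W,S) be a finite Coxeter system. For every subset J of the set S of simple reflections and for every integer k ≥ 1, the number of k-chains u₁ ≤ u₂ ≤ … ≤ u_k whose top element u_k has support equal to J is the same for the shard order ≤_σ on W as for the BHZ order ≤_β on W. -/

import Mathlib

open scoped Classical

namespace ShardBHZ

variable {B : Type*} {W : Type*} [Group W] {M : CoxeterMatrix B} (cs : CoxeterSystem M W)

/-- The support `S(w)` of `w`: the set of simple reflections appearing in some
(equivalently, any) reduced word for `w`. -/
def supp (w : W) : Set B := {i | ∃ l : List B, cs.IsReduced l ∧ cs.wordProd l = w ∧ i ∈ l}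

/-- The standard parabolic subgroup `W_I` generated by the simple reflections in `I`. -/
def parab (I : Set B) : Subgroup W := Subgroup.closure (cs.simple '' I)

/-- `x` has no right descent in `I`; this characterizes the minimal length coset
representatives `W^I` of `W / W_I`. -/
def IsMinRep (I : Set B) (x : W) : Prop := ∀ i ∈ I, ¬ cs.IsRightDescent x i

/-- The BHZ order: `u ≤_β v` iff the parabolic component `v_{S(u)}` equals `u`, i.e.
`v = (v * u⁻¹) * u` is the parabolic factorization of `v` with respect to `W_{S(u)}`:
`u ∈ W_{S(u)}`, `v * u⁻¹` has no right descent in `S(u)`, and lengths add. -/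
def bhzLE (u v : W) : Prop :=
  u ∈ parab cs (supp cs u) ∧ IsMinRep cs (supp cs u) (v * u⁻¹) ∧
    cs.length v = cs.length (v * u⁻¹) + cs.length u

/-- The set `N(w)` of left inversions of `w`. -/
def invSet (w : W) : Set W := {t | cs.IsLeftInversion w t}

/-- The subgroup `G(w)` generated by `w * s * w⁻¹` for `s` a right descent of `w`. -/
def descConj (w : W) : Subgroup W :=
  Subgroup.closure {x | ∃ i, cs.IsRightDescent w i ∧ x = w * cs.simple i * w⁻¹}

/-- The shard intersection order: `u ≤_σ v` iff `N(u) ⊆ N(v)` and `G(u) ⊆ G(v)`. -/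
def shardLE (u v : W) : Prop := invSet cs u ⊆ invSet cs v ∧ descConj cs u ≤ descConj cs v

/-! ### The reflection cocycle -/

/-- The action of a simple reflection on pairs of a group element and a sign. -/
noncomputable def signedConj (i : B) : Function.End (W × ZMod 2) := fun p =>
  (cs.simple i * p.1 * cs.simple i, p.2 + if p.1 = cs.simple i then 1 else 0)

theorem signedConj_mul_pow_apply (i j : B) (n : ℕ) (t : W) (e : ZMod 2) :
    ((signedConj cs i * signedConj cs j) ^ n : Function.End (W × ZMod 2)) (t, e) =
      ((cs.simple i * cs.simple j) ^ n * t * ((cs.simple i * cs.simple j) ^ n)⁻¹,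
        e + ∑ k ∈ Finset.range (2 * n),
          if t = (cs.simple j * cs.simple i) ^ k * cs.simple j then 1 else 0) := by
  induction n with
  | zero => simp [Function.End.one_def]
  | succ n ih =>
    have hinv : ((cs.simple i * cs.simple j) ^ n)⁻¹ = (cs.simple j * cs.simple i) ^ n := by
      rw [← inv_pow]; simp
    have hcomm : cs.simple j * (cs.simple i * cs.simple j) ^ n =
        (cs.simple j * cs.simple i) ^ n * cs.simple j :=
      (mul_pow_mul (cs.simple j) (cs.simple i) n).symm
    have h₁ : (cs.simple i * cs.simple j) ^ n * t * (cs.simple j * cs.simple i) ^ n =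
        cs.simple j ↔ t = (cs.simple j * cs.simple i) ^ (2 * n) * cs.simple j := by
      rw [two_mul, pow_add, mul_assoc _ _ (cs.simple j), ← hcomm, ← hinv, mul_inv_eq_iff_eq_mul,
        eq_inv_mul_iff_mul_eq]
    have h₂ : cs.simple j * ((cs.simple i * cs.simple j) ^ n * t *
        (cs.simple j * cs.simple i) ^ n) * cs.simple j = cs.simple i ↔
        t = (cs.simple j * cs.simple i) ^ (2 * n + 1) * cs.simple j := by
      have e₁ : (cs.simple j * cs.simple i) ^ (2 * n + 1) * cs.simple j =
          ((cs.simple i * cs.simple j) ^ n)⁻¹ * (cs.simple j * cs.simple i * cs.simple j *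
            (cs.simple i * cs.simple j) ^ n) := by
        rw [hinv, mul_assoc _ (cs.simple j), hcomm, ← mul_assoc (cs.simple j * cs.simple i),
          ← pow_succ', ← mul_assoc, ← pow_add]
        congr 2; omega
      rw [e₁, ← hinv, eq_inv_mul_iff_mul_eq, ← mul_inv_eq_iff_eq_mul]
      generalize (cs.simple i * cs.simple j) ^ n * t * ((cs.simple i * cs.simple j) ^ n)⁻¹ = x
      constructor
      · rintro h
        rw [← h]; simp [mul_assoc]
      · rintro rfl
        simp [mul_assoc]
    have hstep : ∀ p : W × ZMod 2, (signedConj cs i * signedConj cs j) p =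
        (cs.simple i * (cs.simple j * p.1 * cs.simple j) * cs.simple i,
          p.2 + (if p.1 = cs.simple j then 1 else 0) +
            if cs.simple j * p.1 * cs.simple j = cs.simple i then 1 else 0) := fun p => rfl
    rw [pow_succ']
    change (signedConj cs i * signedConj cs j)
      (((signedConj cs i * signedConj cs j) ^ n : Function.End (W × ZMod 2)) (t, e)) = _
    rw [ih, hstep, hinv]
    simp only [h₁, h₂]
    rw [show 2 * (n + 1) = 2 * n + 1 + 1 by ring, Finset.sum_range_succ, Finset.sum_range_succ]
    rw [Prod.mk.injEq]
    refine ⟨?_, by simp only [add_assoc]⟩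
    rw [pow_succ', mul_inv_rev, hinv]
    simp [mul_assoc]

theorem isLiftable_signedConj : M.IsLiftable (signedConj cs) := by
  intro i j
  funext ⟨t, e⟩
  rw [signedConj_mul_pow_apply, cs.simple_mul_simple_pow, two_mul, Finset.sum_range_add]
  have : ∀ k, (cs.simple j * cs.simple i) ^ (M i j + k) = (cs.simple j * cs.simple i) ^ k := by
    intro k
    rw [pow_add, cs.simple_mul_simple_pow', one_mul]
  simp only [this, CharTwo.add_self_eq_zero]
  simp [Function.End.one_def]

/-- The sign representation of `W` on pairs of a group element and a sign. -/
noncomputable def signedAction : W →* Function.End (W × ZMod 2) :=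
  cs.lift ⟨signedConj cs, isLiftable_signedConj cs⟩

/-- The parity of the number of occurrences of `t` as a right inversion along a word for `w`. -/
noncomputable def rightParity (w t : W) : ZMod 2 := (signedAction cs w (t, 0)).2

theorem signedAction_simple (i : B) (p : W × ZMod 2) : signedAction cs (cs.simple i) p =
    (cs.simple i * p.1 * cs.simple i, p.2 + if p.1 = cs.simple i then 1 else 0) := by
  rw [signedAction, cs.lift_apply_simple]
  rfl

theorem signedAction_apply (w t : W) (e : ZMod 2) :
    signedAction cs w (t, e) = (w * t * w⁻¹, e + rightParity cs w t) := by
  induction w using cs.simple_induction_left generalizing t e with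
  | one => simp [rightParity, Function.End.one_def]
  | mul_simple_left w i ih =>
    have key : ∀ e, signedAction cs (cs.simple i * w) (t, e) =
        (cs.simple i * w * t * (cs.simple i * w)⁻¹, e + (rightParity cs w t +
          if w * t * w⁻¹ = cs.simple i then 1 else 0)) := by
      intro e
      rw [map_mul]
      change signedAction cs (cs.simple i) (signedAction cs w (t, e)) = _
      rw [ih, signedAction_simple]
      simp [mul_assoc, add_assoc]
    have h : rightParity cs (cs.simple i * w) t = rightParity cs w t +
        if w * t * w⁻¹ = cs.simple i then 1 else 0 := by
      rw [rightParity, key 0, zero_add]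
    rw [key, h]

theorem rightParity_mul (u v t : W) :
    rightParity cs (u * v) t = rightParity cs v t + rightParity cs u (v * t * v⁻¹) := by
  have h : signedAction cs (u * v) (t, 0) = signedAction cs u (signedAction cs v (t, 0)) := by
    rw [map_mul]; rfl
  rw [rightParity, h, signedAction_apply, signedAction_apply, zero_add]

theorem rightParity_one (t : W) : rightParity cs 1 t = 0 := by
  simp [rightParity, Function.End.one_def]

theorem rightParity_simple (i : B) (t : W) :
    rightParity cs (cs.simple i) t = if t = cs.simple i then 1 else 0 := by
  rw [rightParity, signedAction_simple, zero_add]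

theorem rightParity_self {t : W} (ht : cs.IsReflection t) : rightParity cs t t = 1 := by
  obtain ⟨a, i, rfl⟩ := ht
  have h := rightParity_mul cs a a⁻¹ (a * cs.simple i * a⁻¹)
  rw [mul_inv_cancel, rightParity_one, inv_inv,
    show a⁻¹ * (a * cs.simple i * a⁻¹) * a = cs.simple i by group] at h
  rw [rightParity_mul, rightParity_mul, inv_inv,
    show a⁻¹ * (a * cs.simple i * a⁻¹) * a = cs.simple i by group, rightParity_simple,
    if_pos rfl, mul_inv_cancel_right, add_left_comm, ← h, add_zero]

theorem mem_rightInvSeq_of_rightParity {l : List B} {t : W}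
    (h : rightParity cs (cs.wordProd l) t = 1) : t ∈ cs.rightInvSeq l := by
  induction l with
  | nil => simp [rightParity_one] at h
  | cons i l ih =>
    rw [cs.wordProd_cons, rightParity_mul, rightParity_simple] at h
    rw [CoxeterSystem.rightInvSeq, List.mem_cons]
    by_cases hi : cs.wordProd l * t * (cs.wordProd l)⁻¹ = cs.simple i
    · left
      rw [← hi]; group
    · right
      rw [if_neg hi, add_zero] at h
      exact ih h

theorem isRightInversion_iff_rightParity {w t : W} (ht : cs.IsReflection t) :
    cs.IsRightInversion w t ↔ rightParity cs w t = 1 := by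
  have key : ∀ w, rightParity cs w t = 1 → cs.IsRightInversion w t := by
    intro w h
    obtain ⟨l, hl, rfl⟩ := cs.exists_isReduced w
    exact cs.isRightInversion_of_mem_rightInvSeq hl (mem_rightInvSeq_of_rightParity cs h)
  refine ⟨fun h => ?_, key w⟩
  by_contra h1
  have h0 : rightParity cs w t = 0 := by
    generalize rightParity cs w t = z at h1
    revert z; decide
  refine ht.not_isRightInversion_mul_left_iff.2 h (key _ ?_)
  rw [rightParity_mul, rightParity_self cs ht, mul_inv_cancel_right, h0, add_zero]

/-! ### Inversion sets -/

theorem mem_invSet_iff {w t : W} (ht : cs.IsReflection t) :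
    t ∈ invSet cs w ↔ rightParity cs w⁻¹ t = 1 := by
  rw [← isRightInversion_iff_rightParity cs ht, cs.isRightInversion_inv_iff]
  rfl

theorem isReflection_conj' {u t : W} : cs.IsReflection (u⁻¹ * t * u) ↔ cs.IsReflection t := by
  simpa using cs.isReflection_conj_iff u⁻¹ t

theorem mem_invSet_mul (u v t : W) :
    t ∈ invSet cs (u * v) ↔ ¬(t ∈ invSet cs u ↔ u⁻¹ * t * u ∈ invSet cs v) := by
  by_cases ht : cs.IsReflection t
  · rw [mem_invSet_iff cs ht, mem_invSet_iff cs ht,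
      mem_invSet_iff cs ((isReflection_conj' cs).2 ht), mul_inv_rev, rightParity_mul, inv_inv]
    generalize rightParity cs u⁻¹ t = a
    generalize rightParity cs v⁻¹ (u⁻¹ * t * u) = b
    revert a b; decide
  · have h₁ : t ∉ invSet cs u := fun h => ht h.1
    have h₂ : t ∉ invSet cs (u * v) := fun h => ht h.1
    have h₃ : u⁻¹ * t * u ∉ invSet cs v := fun h => ht ((isReflection_conj' cs).1 h.1)
    tauto

theorem notMem_invSet_one (t : W) : t ∉ invSet cs 1 := by
  rintro ⟨-, h⟩
  simp at h

theorem mem_invSet_simple {i : B} {t : W} : t ∈ invSet cs (cs.simple i) ↔ t = cs.simple i := by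
  constructor
  · intro h
    have := (mem_invSet_iff cs h.1).1 h
    rw [cs.inv_simple, rightParity_simple] at this
    by_contra hne
    simp [hne] at this
  · rintro rfl
    rw [mem_invSet_iff cs (cs.isReflection_simple i), cs.inv_simple, rightParity_simple, if_pos rfl]

theorem mem_invSet_inv {x t : W} : t ∈ invSet cs x⁻¹ ↔ x * t * x⁻¹ ∈ invSet cs x := by
  have h := mem_invSet_mul cs x x⁻¹ (x * t * x⁻¹)
  rw [mul_inv_cancel, show x⁻¹ * (x * t * x⁻¹) * x = t by group] at h
  have := notMem_invSet_one cs (x * t * x⁻¹)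
  tauto

theorem mem_invSet_mul_simple {w t : W} {i : B} :
    t ∈ invSet cs (w * cs.simple i) ↔ ¬(t ∈ invSet cs w ↔ t = w * cs.simple i * w⁻¹) := by
  rw [mem_invSet_mul, mem_invSet_simple]
  have : w⁻¹ * t * w = cs.simple i ↔ t = w * cs.simple i * w⁻¹ := by
    constructor
    · intro h; rw [← h]; group
    · rintro rfl; group
  rw [this]

theorem isRightDescent_iff_mem {w : W} {i : B} :
    cs.IsRightDescent w i ↔ w * cs.simple i * w⁻¹ ∈ invSet cs w := by
  have : cs.IsReflection (w * cs.simple i * w⁻¹) := (cs.isReflection_simple i).conj w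
  simp [invSet, CoxeterSystem.IsLeftInversion, this, CoxeterSystem.IsRightDescent]

theorem isLeftDescent_iff_mem {w : W} {i : B} :
    cs.IsLeftDescent w i ↔ cs.simple i ∈ invSet cs w :=
  (cs.isLeftInversion_simple_iff_isLeftDescent w i).symm

theorem eq_one_of_forall_simple_notMem {m : W} (h : ∀ i, cs.simple i ∉ invSet cs m) : m = 1 := by
  by_contra hm
  obtain ⟨i, hi⟩ := cs.exists_leftDescent_of_ne_one hm
  exact h i ((isLeftDescent_iff_mem cs).1 hi)

/-- If `N(u) ⊆ N(y)` then the inversions of `u⁻¹ * y` are the further inversions of `y`. -/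
theorem mem_invSet_inv_mul {u y : W} (h : invSet cs u ⊆ invSet cs y) (t : W) :
    t ∈ invSet cs (u⁻¹ * y) ↔ u * t * u⁻¹ ∈ invSet cs y ∧ u * t * u⁻¹ ∉ invSet cs u := by
  rw [mem_invSet_mul, mem_invSet_inv, inv_inv]
  have := @h (u * t * u⁻¹)
  tauto

theorem invSet_injective : Function.Injective (invSet cs) := by
  intro u y h
  have : u⁻¹ * y = 1 := eq_one_of_forall_simple_notMem cs fun i hi => by
    rw [mem_invSet_inv_mul cs h.le, h] at hi
    exact hi.2 hi.1
  rw [inv_mul_eq_one] at this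
  exact this

/-- A strict weak-order relation factors through a lower cover of the larger element. -/
theorem exists_isRightDescent_notMem {u y : W} (h : invSet cs u ⊆ invSet cs y) (hne : u ≠ y) :
    ∃ i, cs.IsRightDescent y i ∧ y * cs.simple i * y⁻¹ ∉ invSet cs u := by
  have hm : u⁻¹ * y ≠ 1 := by rwa [Ne, inv_mul_eq_one]
  obtain ⟨i, hi⟩ := cs.exists_rightDescent_of_ne_one hm
  rw [isRightDescent_iff_mem, mem_invSet_inv_mul cs h] at hi
  have e : u * (u⁻¹ * y * cs.simple i * (u⁻¹ * y)⁻¹) * u⁻¹ = y * cs.simple i * y⁻¹ := by group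
  rw [e] at hi
  exact ⟨i, (isRightDescent_iff_mem cs).2 hi.1, hi.2⟩

theorem subset_invSet_mul_simple {u y : W} {i : B} (h : invSet cs u ⊆ invSet cs y)
    (hi : y * cs.simple i * y⁻¹ ∉ invSet cs u) :
    invSet cs u ⊆ invSet cs (y * cs.simple i) := by
  intro t ht
  rw [mem_invSet_mul_simple]
  have h₁ := h ht
  have : t ≠ y * cs.simple i * y⁻¹ := by rintro rfl; exact hi ht
  tauto

theorem mem_invSet_mul_simple_of_descent {y t : W} {i : B} (hi : cs.IsRightDescent y i) :
    t ∈ invSet cs (y * cs.simple i) ↔ t ∈ invSet cs y ∧ t ≠ y * cs.simple i * y⁻¹ := by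
  rw [mem_invSet_mul_simple]
  rw [isRightDescent_iff_mem] at hi
  by_cases h : t = y * cs.simple i * y⁻¹
  · subst h; tauto
  · tauto

/-! ### Standard parabolic subgroups -/

variable {J K : Set B}

theorem simple_mem_parab {j : B} (hj : j ∈ J) : cs.simple j ∈ parab cs J :=
  Subgroup.subset_closure ⟨j, hj, rfl⟩

theorem parab_mono (h : J ⊆ K) : parab cs J ≤ parab cs K :=
  Subgroup.closure_mono (Set.image_mono h)

theorem mem_parab_of_mem_invSet {v t : W} (hv : v ∈ parab cs J) (ht : t ∈ invSet cs v) :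
    t ∈ parab cs J := by
  induction hv using Subgroup.closure_induction generalizing t with
  | mem x hx =>
    obtain ⟨j, hj, rfl⟩ := hx
    rw [mem_invSet_simple] at ht
    exact ht ▸ simple_mem_parab cs hj
  | one => exact absurd ht (notMem_invSet_one cs t)
  | mul a b ha hb iha ihb =>
    rw [mem_invSet_mul] at ht
    by_cases h : t ∈ invSet cs a
    · exact iha h
    · have hb' := ihb (by tauto : a⁻¹ * t * a ∈ invSet cs b)
      have := mul_mem (mul_mem (show a ∈ parab cs J from ha) hb') (inv_mem ha)
      rwa [show a * (a⁻¹ * t * a) * a⁻¹ = t by group] at this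
  | inv a ha iha =>
    rw [mem_invSet_inv] at ht
    have := mul_mem (mul_mem (inv_mem (show a ∈ parab cs J from ha)) (iha ht)) ha
    rwa [show a⁻¹ * (a * t * a⁻¹) * a = t by group] at this

theorem mem_parab_of_invSet_subset {u : W} (h : ∀ t ∈ invSet cs u, t ∈ parab cs J) :
    u ∈ parab cs J := by
  obtain ⟨l, hl, rfl⟩ := cs.exists_isReduced u
  rw [← inv_mem_iff, ← cs.prod_leftInvSeq]
  exact Subgroup.list_prod_mem _ fun t ht => h t (cs.isLeftInversion_of_mem_leftInvSeq hl ht)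

theorem mem_leftInvSeq_of_mem_invSet {l : List B} {t : W} (h : t ∈ invSet cs (cs.wordProd l)) :
    t ∈ cs.leftInvSeq l := by
  have h' := (mem_invSet_iff cs h.1).1 h
  rw [← cs.wordProd_reverse] at h'
  simpa [cs.rightInvSeq_reverse] using mem_rightInvSeq_of_rightParity cs h'

theorem isReduced_cons {l : List B} (hl : cs.IsReduced l) {j : B}
    (hj : cs.simple j ∉ invSet cs (cs.wordProd l)) : cs.IsReduced (j :: l) := by
  rw [← isLeftDescent_iff_mem, cs.not_isLeftDescent_iff] at hj
  rw [CoxeterSystem.IsReduced, cs.wordProd_cons, hj, hl, List.length_cons]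

theorem exists_reduced_word_of_mem_parab {v : W} (hv : v ∈ parab cs J) :
    ∃ l : List B, (∀ i ∈ l, i ∈ J) ∧ cs.IsReduced l ∧ cs.wordProd l = v := by
  have step : ∀ j ∈ J, ∀ v, (∃ l : List B, (∀ i ∈ l, i ∈ J) ∧ cs.IsReduced l ∧ cs.wordProd l = v) →
      ∃ l : List B, (∀ i ∈ l, i ∈ J) ∧ cs.IsReduced l ∧ cs.wordProd l = cs.simple j * v := by
    rintro j hj _ ⟨l, hlJ, hl, rfl⟩
    by_cases h : cs.simple j ∈ invSet cs (cs.wordProd l)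
    · obtain ⟨k, hk, hkj⟩ := List.mem_iff_getElem.1 (mem_leftInvSeq_of_mem_invSet cs h)
      have hprod := cs.getD_leftInvSeq_mul_wordProd l k
      rw [List.getD_eq_getElem _ 1 hk, hkj] at hprod
      rw [cs.length_leftInvSeq] at hk
      refine ⟨l.eraseIdx k, fun i hi => hlJ i (List.mem_of_mem_eraseIdx hi), ?_, hprod.symm⟩
      have h₁ := List.length_eraseIdx_add_one hk
      rw [← isLeftDescent_iff_mem, cs.isLeftDescent_iff, hl.eq, hprod] at h
      rw [CoxeterSystem.IsReduced]
      omega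
    · refine ⟨j :: l, ?_, isReduced_cons cs hl h, cs.wordProd_cons j l⟩
      simpa using ⟨hj, hlJ⟩
  induction hv using Subgroup.closure_induction_left with
  | one => exact ⟨[], by simp, by simp [CoxeterSystem.IsReduced], by simp⟩
  | mul_left x hx y hy ih =>
    obtain ⟨j, hj, rfl⟩ := hx
    exact step j hj y ih
  | inv_mul_cancel x hx y hy ih =>
    obtain ⟨j, hj, rfl⟩ := hx
    rw [cs.inv_simple]
    exact step j hj y ih

theorem exists_simple_mem_invSet {v : W} (hv : v ∈ parab cs J) (hne : v ≠ 1) :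
    ∃ j ∈ J, cs.simple j ∈ invSet cs v := by
  obtain ⟨l, hlJ, hl, rfl⟩ := exists_reduced_word_of_mem_parab cs hv
  cases l with
  | nil => simp at hne
  | cons j l =>
    refine ⟨j, hlJ j (by simp), cs.isLeftInversion_of_mem_leftInvSeq hl ?_⟩
    simp [CoxeterSystem.leftInvSeq]

theorem simple_ne_one (i : B) : cs.simple i ≠ 1 := by
  intro h
  have := cs.length_simple i
  rw [h, cs.length_one] at this
  omega

theorem simple_mem_parab_iff {i : B} :
    cs.simple i ∈ parab cs J ↔ ∃ j ∈ J, cs.simple i = cs.simple j := by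
  constructor
  · intro h
    obtain ⟨j, hj, hji⟩ := exists_simple_mem_invSet cs h (simple_ne_one cs i)
    exact ⟨j, hj, ((mem_invSet_simple cs).1 hji).symm⟩
  · rintro ⟨j, hj, h⟩
    exact h ▸ simple_mem_parab cs hj

/-- `m` is the minimal length element of its coset `W_J m`. -/
def LeftMin (J : Set B) (m : W) : Prop := ∀ t ∈ parab cs J, t ∉ invSet cs m

theorem LeftMin.mem_invSet_mul {v m t : W} (hm : LeftMin cs J m) (hv : v ∈ parab cs J)
    (ht : t ∈ parab cs J) : t ∈ invSet cs (v * m) ↔ t ∈ invSet cs v := by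
  rw [ShardBHZ.mem_invSet_mul]
  have := hm (v⁻¹ * t * v) (mul_mem (mul_mem (inv_mem hv) ht) hv)
  tauto

theorem exists_leftMin (J : Set B) (u : W) : ∃ v ∈ parab cs J, LeftMin cs J (v⁻¹ * u) := by
  obtain ⟨v, hv, hmin⟩ := exists_minimalFor_of_wellFoundedLT
    (fun v : W => v ∈ parab cs J) (fun v => cs.length (v⁻¹ * u)) ⟨1, one_mem _⟩
  refine ⟨v, hv, fun t ht hmem => ?_⟩
  have h := hmem.2
  have h₂ := @hmin (v * t⁻¹) (mul_mem hv (inv_mem ht))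
  simp only [mul_inv_rev, inv_inv, mul_assoc] at h h₂
  have := h₂ h.le
  omega

theorem leftMin_of_forall_simple {m : W} (h : ∀ j ∈ J, cs.simple j ∉ invSet cs m) :
    LeftMin cs J m := by
  obtain ⟨v, hv, hmin⟩ := exists_leftMin cs J m
  by_cases h1 : v = 1
  · simpa [h1] using hmin
  · obtain ⟨j, hj, hjv⟩ := exists_simple_mem_invSet cs hv h1
    rw [← hmin.mem_invSet_mul cs hv (simple_mem_parab cs hj), mul_inv_cancel_left] at hjv
    exact absurd hjv (h j hj)

theorem LeftMin.length_mul {v m : W} (hm : LeftMin cs J m) (hv : v ∈ parab cs J) :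
    cs.length (v * m) = cs.length v + cs.length m := by
  obtain ⟨l, hlJ, hl, rfl⟩ := exists_reduced_word_of_mem_parab cs hv
  clear hv
  induction l with
  | nil => simp
  | cons j l ih =>
    have hl' : cs.IsReduced l := by simpa using hl.drop 1
    have hlP : cs.wordProd l ∈ parab cs J :=
      Subgroup.list_prod_mem _ fun x hx => by
        obtain ⟨i, hi, rfl⟩ := List.mem_map.1 hx
        exact simple_mem_parab cs (hlJ i (by simp [hi]))
    have hd : ¬ cs.IsLeftDescent (cs.wordProd l) j := by
      rw [cs.not_isLeftDescent_iff, ← cs.wordProd_cons, hl, hl', List.length_cons]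
    have hd' := hd
    rw [isLeftDescent_iff_mem, ← hm.mem_invSet_mul cs hlP (simple_mem_parab cs (hlJ j (by simp))),
      ← isLeftDescent_iff_mem, cs.not_isLeftDescent_iff] at hd'
    rw [cs.not_isLeftDescent_iff] at hd
    rw [cs.wordProd_cons, mul_assoc, hd', ih (fun i hi => hlJ i (by simp [hi])) hl', hd]
    ring

/-- `x` is the minimal length element of its coset `x W_J`. -/
def RightMin (J : Set B) (x : W) : Prop := LeftMin cs J x⁻¹

theorem RightMin.notMem {x t : W} (hx : RightMin cs J x) (ht : t ∈ parab cs J) :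
    x * t * x⁻¹ ∉ invSet cs x := by
  rw [← mem_invSet_inv]
  exact hx t ht

theorem RightMin.notMem_of_conj_mem {x t : W} (hx : RightMin cs J x)
    (ht : x⁻¹ * t * x ∈ parab cs J) : t ∉ invSet cs x := by
  have := hx.notMem cs ht
  rwa [show x * (x⁻¹ * t * x) * x⁻¹ = t by group] at this

theorem RightMin.mem_invSet_mul {x p t : W} (hx : RightMin cs J x) (hp : p ∈ parab cs J) :
    t ∈ invSet cs (x * p) ↔ t ∈ invSet cs x ∨ x⁻¹ * t * x ∈ invSet cs p := by
  rw [ShardBHZ.mem_invSet_mul]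
  have h₁ : x⁻¹ * t * x ∈ invSet cs p → t ∉ invSet cs x := fun h =>
    hx.notMem_of_conj_mem cs (mem_parab_of_mem_invSet cs hp h)
  tauto

theorem RightMin.conj_mem_invSet_mul {x p t : W} (hx : RightMin cs J x) (hp : p ∈ parab cs J)
    (ht : t ∈ parab cs J) : x * t * x⁻¹ ∈ invSet cs (x * p) ↔ t ∈ invSet cs p := by
  rw [hx.mem_invSet_mul cs hp, show x⁻¹ * (x * t * x⁻¹) * x = t by group]
  have := hx.notMem cs ht
  tauto

theorem RightMin.length_mul {x p : W} (hx : RightMin cs J x) (hp : p ∈ parab cs J) :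
    cs.length (x * p) = cs.length x + cs.length p := by
  have := LeftMin.length_mul cs hx (inv_mem hp)
  rw [← cs.length_inv, mul_inv_rev, this, cs.length_inv, cs.length_inv, add_comm]

theorem exists_rightMin (J : Set B) (u : W) : ∃ p ∈ parab cs J, RightMin cs J (u * p⁻¹) := by
  obtain ⟨v, hv, hmin⟩ := exists_leftMin cs J u⁻¹
  refine ⟨v⁻¹, inv_mem hv, ?_⟩
  rw [RightMin, mul_inv_rev, inv_inv]
  exact hmin

theorem isMinRep_iff_rightMin {x : W} : IsMinRep cs J x ↔ RightMin cs J x := by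
  constructor
  · intro h
    refine leftMin_of_forall_simple cs fun j hj hmem => h j hj ?_
    rwa [isRightDescent_iff_mem, ← mem_invSet_inv]
  · intro h j hj hd
    rw [isRightDescent_iff_mem] at hd
    exact h.notMem cs (simple_mem_parab cs hj) hd

/-! ### Supports -/

/-- A set of indices that contains, with an index, all indices of the same simple reflection. -/
def Saturated (K : Set B) : Prop := ∀ i j, cs.simple i = cs.simple j → i ∈ K → j ∈ K

theorem saturated_supp (w : W) : Saturated cs (supp cs w) := by
  rintro i j hij ⟨l, hl, rfl, hil⟩
  have hprod : cs.wordProd (l.map fun a => if a = i then j else a) = cs.wordProd l := by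
    rw [CoxeterSystem.wordProd, CoxeterSystem.wordProd, List.map_map]
    congr 1
    refine List.map_congr_left fun a _ => ?_
    by_cases h : a = i <;> simp [h, hij]
  refine ⟨_, ?_, hprod, List.mem_map.2 ⟨i, hil, by simp⟩⟩
  rw [CoxeterSystem.IsReduced, hprod, hl, List.length_map]

theorem mem_parab_supp (w : W) : w ∈ parab cs (supp cs w) := by
  obtain ⟨l, hl, rfl⟩ := cs.exists_isReduced w
  refine Subgroup.list_prod_mem _ fun x hx => ?_
  obtain ⟨i, hi, rfl⟩ := List.mem_map.1 hx
  exact simple_mem_parab cs ⟨l, hl, rfl, hi⟩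

theorem exists_simple_eq_of_mem_supp {w : W} {i : B} (hw : w ∈ parab cs K) (hi : i ∈ supp cs w) :
    ∃ k ∈ K, cs.simple i = cs.simple k := by
  obtain ⟨l, hl, rfl, hil⟩ := hi
  rw [← simple_mem_parab_iff]
  induction l with
  | nil => simp at hil
  | cons j l ih =>
    have hj : cs.simple j ∈ parab cs K := mem_parab_of_mem_invSet cs hw
      (cs.isLeftInversion_of_mem_leftInvSeq hl (by simp [CoxeterSystem.leftInvSeq]))
    rcases List.mem_cons.1 hil with rfl | hil
    · exact hj
    · rw [cs.wordProd_cons, Subgroup.mul_mem_cancel_left _ hj] at hw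
      exact ih (by simpa using hl.drop 1) hil hw

theorem Saturated.mem_parab_iff {w : W} (hK : Saturated cs K) :
    w ∈ parab cs K ↔ supp cs w ⊆ K := by
  refine ⟨fun hw i hi => ?_, fun h => parab_mono cs h (mem_parab_supp cs w)⟩
  obtain ⟨k, hk, hik⟩ := exists_simple_eq_of_mem_supp cs hw hi
  exact hK k i hik.symm hk

theorem Saturated.simple_mem_parab_iff {i : B} (hK : Saturated cs K) :
    cs.simple i ∈ parab cs K ↔ i ∈ K := by
  refine ⟨fun h => ?_, simple_mem_parab cs⟩
  obtain ⟨k, hk, hik⟩ := (ShardBHZ.simple_mem_parab_iff cs).1 h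
  exact hK k i hik.symm hk

theorem Saturated.union (hJ : Saturated cs J) (hK : Saturated cs K) : Saturated cs (J ∪ K) :=
  fun i j h => Or.imp (hJ i j h) (hK i j h)

theorem supp_mul {a b : W} (h : cs.length (a * b) = cs.length a + cs.length b) :
    supp cs (a * b) = supp cs a ∪ supp cs b := by
  apply subset_antisymm
  · rw [← ((saturated_supp cs a).union cs (saturated_supp cs b)).mem_parab_iff]
    exact mul_mem (parab_mono cs Set.subset_union_left (mem_parab_supp cs a))
      (parab_mono cs Set.subset_union_right (mem_parab_supp cs b))
  · have key : ∀ l l', cs.IsReduced l → cs.wordProd l = a → cs.IsReduced l' →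
        cs.wordProd l' = b → cs.IsReduced (l ++ l') ∧ cs.wordProd (l ++ l') = a * b := by
      rintro l l' hl rfl hl' rfl
      rw [CoxeterSystem.IsReduced, cs.wordProd_append, h, hl, hl', List.length_append]
      exact ⟨rfl, rfl⟩
    rintro i (⟨l, hl, hla, hi⟩ | ⟨l, hl, hlb, hi⟩)
    · obtain ⟨l', hl', hl'b⟩ := cs.exists_isReduced b
      obtain ⟨h₁, h₂⟩ := key l l' hl hla hl' hl'b.symm
      exact ⟨_, h₁, h₂, by simp [hi]⟩
    · obtain ⟨l', hl', hl'a⟩ := cs.exists_isReduced a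
      obtain ⟨h₁, h₂⟩ := key l' l hl' hl'a.symm hl hlb
      exact ⟨_, h₁, h₂, by simp [hi]⟩

/-! ### Descents and longest elements -/

/-- The right descent set of `w`. -/
def descents (w : W) : Set B := {i | cs.IsRightDescent w i}

theorem mem_descents {w : W} {i : B} :
    i ∈ descents cs w ↔ w * cs.simple i * w⁻¹ ∈ invSet cs w :=
  isRightDescent_iff_mem cs

theorem saturated_descents (w : W) : Saturated cs (descents cs w) := by
  intro i j hij hi
  simpa [descents, CoxeterSystem.IsRightDescent, hij] using hi

theorem descents_subset_parab {w : W} (hw : w ∈ parab cs J) {i : B} (hi : i ∈ descents cs w) :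
    cs.simple i ∈ parab cs J := by
  have := mem_parab_of_mem_invSet cs hw ((mem_descents cs).1 hi)
  rwa [Subgroup.mul_mem_cancel_right _ (inv_mem hw), Subgroup.mul_mem_cancel_left _ hw] at this

theorem exists_longest [Finite W] (J : Set B) :
    ∃ p ∈ parab cs J, ∀ t ∈ parab cs J, cs.IsReflection t → t ∈ invSet cs p := by
  obtain ⟨p, hp, hmax⟩ := (Set.toFinite (parab cs J : Set W)).exists_maximalFor cs.length _
    ⟨1, one_mem _⟩
  refine ⟨p, hp, fun t ht hr => ⟨hr, lt_of_le_of_ne ?_ (hr.length_mul_right_ne p)⟩⟩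
  rcases le_total (cs.length p) (cs.length (t * p)) with h | h
  · exact hmax (mul_mem ht hp) h
  · exact h

/-- The longest element of the parabolic subgroup `W_J`. -/
noncomputable def longest [Finite W] (J : Set B) : W := (exists_longest cs J).choose

theorem longest_mem [Finite W] (J : Set B) : longest cs J ∈ parab cs J :=
  (exists_longest cs J).choose_spec.1

theorem mem_invSet_longest [Finite W] {t : W} :
    t ∈ invSet cs (longest cs J) ↔ t ∈ parab cs J ∧ cs.IsReflection t :=
  ⟨fun h => ⟨mem_parab_of_mem_invSet cs (longest_mem cs J) h, h.1⟩,
    fun h => (exists_longest cs J).choose_spec.2 t h.1 h.2⟩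

theorem subset_descents_longest [Finite W] (J : Set B) : J ⊆ descents cs (longest cs J) := by
  intro j hj
  rw [mem_descents, mem_invSet_longest]
  have := longest_mem cs J
  exact ⟨mul_mem (mul_mem this (simple_mem_parab cs hj)) (inv_mem this),
    (cs.isReflection_simple j).conj _⟩

theorem eq_longest [Finite W] {p : W} (hp : p ∈ parab cs J) (h : J ⊆ descents cs p) :
    p = longest cs J := by
  rw [← inv_mul_eq_one]
  by_contra hne
  obtain ⟨j, hj, hmem⟩ := exists_simple_mem_invSet cs (mul_mem (inv_mem hp) (longest_mem cs J)) hne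
  have hsub : invSet cs p ⊆ invSet cs (longest cs J) := fun t ht =>
    (mem_invSet_longest cs).2 ⟨mem_parab_of_mem_invSet cs hp ht, ht.1⟩
  rw [mem_invSet_inv_mul cs hsub] at hmem
  exact hmem.2 ((mem_descents cs).1 (h hj))

theorem supp_longest [Finite W] (hJ : Saturated cs J) : supp cs (longest cs J) = J := by
  refine subset_antisymm ((hJ.mem_parab_iff cs).1 (longest_mem cs J)) fun j hj => ?_
  rw [← (saturated_supp cs _).simple_mem_parab_iff]
  refine mem_parab_of_mem_invSet cs (mem_parab_supp cs (longest cs J)) ?_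
  exact (mem_invSet_longest cs).2 ⟨simple_mem_parab cs hj, cs.isReflection_simple j⟩

/-- If `J` consists of right descents of `w`, then `w` factors through the longest element
of `W_J`. -/
theorem rightMin_mul_longest_inv [Finite W] {w : W} (h : J ⊆ descents cs w) :
    RightMin cs J (w * (longest cs J)⁻¹) := by
  obtain ⟨p, hp, hx⟩ := exists_rightMin cs J w
  rwa [← eq_longest cs hp fun j hj => ?_]
  have hw := h hj
  rw [mem_descents] at hw ⊢
  rw [← hx.conj_mem_invSet_mul cs hp (mul_mem (mul_mem hp (simple_mem_parab cs hj)) (inv_mem hp))]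
  convert hw using 1 <;> group

theorem RightMin.mul_descents {x p : W} (hx : RightMin cs J x) (hp : p ∈ parab cs J) :
    descents cs p ⊆ descents cs (x * p) := by
  intro i hi
  have hip := descents_subset_parab cs hp hi
  rw [mem_descents] at hi ⊢
  rw [← hx.conj_mem_invSet_mul cs hp (mul_mem (mul_mem hp hip) (inv_mem hp))] at hi
  convert hi using 1; group

/-! ### Minimal elements with prescribed cover reflections -/

/-- The elements weakly below `y` having the cover reflections of `y` indexed by `R` as
inversions. -/
def Above (y : W) (R : Set B) : Set W :=
  {u | invSet cs u ⊆ invSet cs y ∧ ∀ i ∈ R, y * cs.simple i * y⁻¹ ∈ invSet cs u}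

/-- `u` belongs to `Above y R` but none of its lower covers does. -/
def IsCore (y : W) (R : Set B) (u : W) : Prop :=
  u ∈ Above cs y R ∧
    ∀ s ∈ descents cs u, ∃ i ∈ R, u * cs.simple s * u⁻¹ = y * cs.simple i * y⁻¹

variable {y : W} {R : Set B}

theorem mul_simple_mem_above {u : W} (hu : u ∈ Above cs y R) {s : B} (hs : s ∈ descents cs u)
    (h : ∀ i ∈ R, y * cs.simple i * y⁻¹ ≠ u * cs.simple s * u⁻¹) :
    u * cs.simple s ∈ Above cs y R := by
  refine ⟨fun t ht => hu.1 ((mem_invSet_mul_simple_of_descent cs hs).1 ht).1, fun i hi => ?_⟩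
  exact (mem_invSet_mul_simple_of_descent cs hs).2 ⟨hu.2 i hi, h i hi⟩

theorem exists_isCore (h : R ⊆ descents cs y) : ∃ u, IsCore cs y R u := by
  obtain ⟨u, hu, hmin⟩ := exists_minimalFor_of_wellFoundedLT
    (fun u : W => u ∈ Above cs y R) cs.length
    ⟨y, subset_rfl, fun i hi => (mem_descents cs).1 (h hi)⟩
  refine ⟨u, hu, fun s hs => ?_⟩
  by_contra! hne
  have h₁ := hmin (mul_simple_mem_above cs hu hs fun i hi => (hne i hi).symm)
  have h₂ : cs.length (u * cs.simple s) < cs.length u := hs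
  have := h₁ h₂.le
  omega

theorem exists_above_le_both {a : W} (ha : a ∈ Above cs y R) {s s' : B}
    (hs : s ∈ descents cs a) (hs' : s' ∈ descents cs a) (has : a * cs.simple s ∈ Above cs y R)
    (has' : a * cs.simple s' ∈ Above cs y R) :
    ∃ b ∈ Above cs y R, invSet cs b ⊆ invSet cs (a * cs.simple s) ∧
      invSet cs b ⊆ invSet cs (a * cs.simple s') := by
  obtain ⟨p, hp, hb⟩ := exists_rightMin cs {s, s'} a
  obtain ⟨b, rfl⟩ : ∃ b, a = b * p := ⟨a * p⁻¹, by simp⟩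
  rw [mul_inv_cancel_right] at hb
  have hsP : cs.simple s ∈ parab cs {s, s'} := simple_mem_parab cs (by simp)
  have hsP' : cs.simple s' ∈ parab cs {s, s'} := simple_mem_parab cs (by simp)
  have hba : invSet cs b ⊆ invSet cs (b * p) := fun t ht => (hb.mem_invSet_mul cs hp).2 (Or.inl ht)
  have hlow : ∀ r, cs.simple r ∈ parab cs {s, s'} →
      invSet cs b ⊆ invSet cs (b * p * cs.simple r) := fun r hr =>
    subset_invSet_mul_simple cs hba <| hb.notMem_of_conj_mem cs <| by
      have := mul_mem (mul_mem hp hr) (inv_mem hp)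
      convert this using 1; group
  refine ⟨b, ⟨hba.trans ha.1, fun i hi => ?_⟩, hlow s hsP, hlow s' hsP'⟩
  rcases (hb.mem_invSet_mul cs hp).1 (ha.2 i hi) with h | h
  · exact h
  exfalso
  set a := b * p with hadef
  set m := a⁻¹ * y with hm
  have hmin : LeftMin cs {s, s'} m := by
    refine leftMin_of_forall_simple cs fun j hj hmem => ?_
    rw [mem_invSet_inv_mul cs ha.1] at hmem
    rcases hj with rfl | rfl
    · exact hmem.2 ((mem_descents cs).1 hs)
    · exact hmem.2 ((mem_descents cs).1 hs')
  have hr : m * cs.simple i * m⁻¹ ∈ parab cs {s, s'} := by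
    have := mul_mem (mul_mem (inv_mem hp) (mem_parab_of_mem_invSet cs hp h)) hp
    convert this using 1
    rw [hm, hadef]; group
  obtain ⟨r, hrP, hrmem⟩ := exists_simple_mem_invSet cs hr (by
    rw [Ne, conj_eq_one_iff]; exact simple_ne_one cs i)
  rw [← hmin.mem_invSet_mul cs hr (simple_mem_parab cs hrP), inv_mul_cancel_right,
    mem_invSet_mul_simple] at hrmem
  have hrm := hmin _ (simple_mem_parab cs hrP)
  have hreq : cs.simple r = m * cs.simple i * m⁻¹ := by tauto
  have ht : a * cs.simple r * a⁻¹ = y * cs.simple i * y⁻¹ := by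
    rw [hreq, hm]; group
  rcases hrP with rfl | rfl
  · exact ((mem_invSet_mul_simple_of_descent cs hs).1 (has.2 i hi)).2 ht.symm
  · exact ((mem_invSet_mul_simple_of_descent cs hs').1 (has'.2 i hi)).2 ht.symm

theorem IsCore.subset_of_le {u a e : W} (hu : IsCore cs y R u) (ha : a ∈ Above cs y R)
    (he : e ∈ Above cs y R) (hua : invSet cs u ⊆ invSet cs a) (hea : invSet cs e ⊆ invSet cs a) :
    invSet cs u ⊆ invSet cs e := by
  induction hn : cs.length a using Nat.strong_induction_on generalizing a e with
  | _ n ih =>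
    subst hn
    by_cases hne : e = a
    · exact hne ▸ hua
    have key : ∀ c ∈ Above cs y R, invSet cs c ⊆ invSet cs a → c ≠ a → ∃ s ∈ descents cs a,
        invSet cs c ⊆ invSet cs (a * cs.simple s) ∧ a * cs.simple s ∈ Above cs y R ∧
          a * cs.simple s * a⁻¹ ∉ invSet cs c := by
      intro c hc hca hne
      obtain ⟨s, hs, hsc⟩ := exists_isRightDescent_notMem cs hca hne
      have hsub := subset_invSet_mul_simple cs hca hsc
      refine ⟨s, hs, hsub, ⟨fun t ht => ha.1 ?_, fun i hi => hsub (hc.2 i hi)⟩, hsc⟩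
      exact ((mem_invSet_mul_simple_of_descent cs hs).1 ht).1
    obtain ⟨s', hs', hes', has', hnot⟩ := key e he hea hne
    by_cases hne' : u = a
    · subst hne'
      obtain ⟨i, hi, heq⟩ := hu.2 s' hs'
      rw [heq] at hnot
      exact absurd (he.2 i hi) hnot
    obtain ⟨s, hs, hus, has, -⟩ := key u hu.1 hua hne'
    obtain ⟨b, hb, hbs, hbs'⟩ := exists_above_le_both cs ha hs hs' has has'
    have hub := ih _ hs has hb hus hbs rfl
    exact ih _ hs' has' he (hub.trans hbs') hes' rfl

theorem IsCore.subset {u e : W} (hR : R ⊆ descents cs y) (hu : IsCore cs y R u)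
    (he : e ∈ Above cs y R) : invSet cs u ⊆ invSet cs e :=
  hu.subset_of_le cs ⟨subset_rfl, fun _ hi => (mem_descents cs).1 (hR hi)⟩ he hu.1.1 he.1

theorem IsCore.unique {u u' : W} (hR : R ⊆ descents cs y) (hu : IsCore cs y R u)
    (hu' : IsCore cs y R u') : u = u' :=
  invSet_injective cs <| subset_antisymm (hu.subset cs hR hu'.1) (hu'.subset cs hR hu.1)

theorem exists_simple_eq_longest_conj [Finite W] {k : B} (hk : k ∈ K) :
    ∃ j, longest cs K * cs.simple k * (longest cs K)⁻¹ = cs.simple j := by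
  set p := longest cs K
  have hp : p ∈ parab cs K := longest_mem cs K
  set r := p * cs.simple k * p⁻¹ with hr
  have hrK : r ∈ parab cs K := mul_mem (mul_mem hp (simple_mem_parab cs hk)) (inv_mem hp)
  obtain ⟨j, hj, hjr⟩ := exists_simple_mem_invSet cs hrK (by
    rw [Ne, hr, conj_eq_one_iff]; exact simple_ne_one cs k)
  refine ⟨j, ?_⟩
  have h₁ := mem_invSet_mul cs r p (cs.simple j)
  have h₂ : r⁻¹ * cs.simple j * r ∈ invSet cs p := by
    refine (mem_invSet_longest cs).2 ⟨?_, (isReflection_conj' cs).2 (cs.isReflection_simple j)⟩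
    exact mul_mem (mul_mem (inv_mem hrK) (simple_mem_parab cs hj)) hrK
  have h₃ : cs.simple j ∈ invSet cs p :=
    (mem_invSet_longest cs).2 ⟨simple_mem_parab cs hj, cs.isReflection_simple j⟩
  rw [hr, inv_mul_cancel_right, mem_invSet_mul_simple, ← hr] at h₁
  have : cs.simple j = r := by tauto
  exact this.symm

/-- Every prescribed cover reflection of `y` is a cover reflection of the core. -/
theorem IsCore.exists_descent [Finite W] {u : W} (hR : R ⊆ descents cs y) (hu : IsCore cs y R u)
    {i : B} (hi : i ∈ R) : ∃ s ∈ descents cs u, u * cs.simple s * u⁻¹ = y * cs.simple i * y⁻¹ := by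
  by_contra! hne
  have hz := rightMin_mul_longest_inv cs hR
  have hp := longest_mem cs R
  have hsimple := fun k (hk : k ∈ R) => exists_simple_eq_longest_conj cs hk
  have hNp : ∀ k ∈ R, longest cs R * cs.simple k * (longest cs R)⁻¹ ∈ invSet cs (longest cs R) :=
    fun k hk => (mem_descents cs).1 (subset_descents_longest cs R hk)
  set p := longest cs R
  obtain ⟨z, rfl⟩ : ∃ z, y = z * p := ⟨y * p⁻¹, by simp⟩
  rw [mul_inv_cancel_right] at hz
  have hconj : ∀ k, z * p * cs.simple k * (z * p)⁻¹ = z * (p * cs.simple k * p⁻¹) * z⁻¹ := by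
    intro k; group
  set R' : Set B := {k | k ∈ R ∧ ∃ s ∈ descents cs u,
    u * cs.simple s * u⁻¹ = z * p * cs.simple k * (z * p)⁻¹} with hR'
  set P : Set B := {j | ∃ k ∈ R', cs.simple j = p * cs.simple k * p⁻¹} with hP
  obtain ⟨q, hq, hm⟩ := exists_leftMin cs P p
  have hPR : parab cs P ≤ parab cs R := by
    rw [parab, Subgroup.closure_le]
    rintro _ ⟨j, ⟨k, hk, hjk⟩, rfl⟩
    rw [hjk]
    exact mul_mem (mul_mem hp (simple_mem_parab cs hk.1)) (inv_mem hp)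
  have hNq : ∀ t ∈ parab cs P, t ∈ invSet cs p ↔ t ∈ invSet cs q := fun t ht => by
    rw [← hm.mem_invSet_mul cs hq ht, mul_inv_cancel_left]
  have he : z * q ∈ Above cs (z * p) R' := by
    constructor
    · intro t ht
      rw [hz.mem_invSet_mul cs (hPR hq)] at ht
      rw [hz.mem_invSet_mul cs hp]
      exact ht.imp_right fun h => (hNq _ (mem_parab_of_mem_invSet cs hq h)).2 h
    · intro k hk
      obtain ⟨j, hj⟩ := hsimple k hk.1
      have hjP : cs.simple j ∈ parab cs P := simple_mem_parab cs ⟨k, hk, hj.symm⟩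
      rw [hconj, hj, hz.conj_mem_invSet_mul cs (hPR hq) (hPR hjP), ← hNq _ hjP, ← hj]
      exact hNp k hk.1
  have hu' : IsCore cs (z * p) R' u :=
    ⟨⟨hu.1.1, fun k hk => hu.1.2 k hk.1⟩, fun s hs => by
      obtain ⟨k, hk, hks⟩ := hu.2 s hs
      exact ⟨k, ⟨hk, s, hs, hks⟩, hks⟩⟩
  have hmem := hu'.subset cs (fun k hk => hR hk.1) he (hu.1.2 i hi)
  obtain ⟨j, hj⟩ := hsimple i hi
  rw [hconj, hz.conj_mem_invSet_mul cs (hPR hq)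
    (mul_mem (mul_mem hp (simple_mem_parab cs hi)) (inv_mem hp)), hj] at hmem
  obtain ⟨j', ⟨k, hk, hjk⟩, hjj'⟩ :=
    (simple_mem_parab_iff cs).1 (mem_parab_of_mem_invSet cs hq hmem)
  obtain ⟨s, hs, hsk⟩ := hk.2
  refine hne s hs ?_
  rw [hsk, hconj, hconj, ← hjk, ← hjj', ← hj]

/-! ### Shard intervals as parabolic subgroups -/

/-- The shard interval attached to the coset `x W_J`: elements whose inversions are inversions
of `x` or lie in `x W_J x⁻¹`, and whose cover reflections all lie in `x W_J x⁻¹`. -/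
def Interval (x : W) (J : Set B) : Set W :=
  {u | (∀ t ∈ invSet cs u, t ∈ invSet cs x ∨ x⁻¹ * t * x ∈ parab cs J) ∧
    ∀ i ∈ descents cs u, x⁻¹ * (u * cs.simple i * u⁻¹) * x ∈ parab cs J}

/-- `v` is the element of `W_J` whose inversion set is `x⁻¹ N(u) x ∩ W_J`. -/
def IsProj (x : W) (J : Set B) (u v : W) : Prop :=
  v ∈ parab cs J ∧ ∀ t ∈ parab cs J, x * t * x⁻¹ ∈ invSet cs u ↔ t ∈ invSet cs v

variable {x : W}

theorem exists_isProj (hx : RightMin cs J x) (u : W) : ∃ v, IsProj cs x J u v := by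
  obtain ⟨v, hv, hm⟩ := exists_leftMin cs J (x⁻¹ * u)
  refine ⟨v, hv, fun t ht => ?_⟩
  rw [← hm.mem_invSet_mul cs hv ht, mul_inv_cancel_left, mem_invSet_mul, inv_inv]
  have := hx t ht
  tauto

theorem IsProj.mem_iff {u v g : W} (h : IsProj cs x J u v) (hg : x⁻¹ * g * x ∈ parab cs J) :
    g ∈ invSet cs u ↔ x⁻¹ * g * x ∈ invSet cs v := by
  rw [← h.2 _ hg, show x * (x⁻¹ * g * x) * x⁻¹ = g by group]

theorem IsProj.unique {u v v' : W} (h : IsProj cs x J u v) (h' : IsProj cs x J u v') : v = v' := by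
  refine invSet_injective cs (Set.ext fun t => ⟨fun ht => ?_, fun ht => ?_⟩)
  · have htJ := mem_parab_of_mem_invSet cs h.1 ht
    rwa [← h'.2 t htJ, h.2 t htJ]
  · have htJ := mem_parab_of_mem_invSet cs h'.1 ht
    rwa [← h.2 t htJ, h'.2 t htJ]

theorem mul_conj_eq (x v s : W) : x * v * s * (x * v)⁻¹ = x * (v * s * v⁻¹) * x⁻¹ := by group

theorem conj_descent_mem_parab {v : W} (hv : v ∈ parab cs J) {i : B} (hi : i ∈ descents cs v) :
    v * cs.simple i * v⁻¹ ∈ parab cs J :=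
  mem_parab_of_mem_invSet cs hv ((mem_descents cs).1 hi)

/-- An element projecting below `v` and having the cover reflections of `v` projects to `v`. -/
theorem IsProj.eq_of_mem_above (hx : RightMin cs J x) {u v v' : W} (hv : v ∈ parab cs J)
    (hu : u ∈ Above cs (x * v) (descents cs v)) (h' : IsProj cs x J u v') : v' = v := by
  by_contra hne
  have hsub : invSet cs v' ⊆ invSet cs v := fun t ht => by
    have htJ := mem_parab_of_mem_invSet cs h'.1 ht
    rw [← h'.2 t htJ] at ht
    exact (hx.conj_mem_invSet_mul cs hv htJ).1 (hu.1 ht)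
  obtain ⟨i, hi, hnot⟩ := exists_isRightDescent_notMem cs hsub hne
  refine hnot ((h'.2 _ (conj_descent_mem_parab cs hv hi)).1 ?_)
  rw [← mul_conj_eq]
  exact hu.2 i hi

theorem IsProj.isCore (hx : RightMin cs J x) {u v : W} (hu : u ∈ Interval cs x J)
    (h : IsProj cs x J u v) : IsCore cs (x * v) (descents cs v) u := by
  have habove : u ∈ Above cs (x * v) (descents cs v) := by
    refine ⟨fun t ht => (hx.mem_invSet_mul cs h.1).2 ?_, fun i hi => ?_⟩
    · by_cases htJ : x⁻¹ * t * x ∈ parab cs J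
      · exact Or.inr ((h.mem_iff cs htJ).1 ht)
      · exact Or.inl ((hu.1 t ht).resolve_right htJ)
    · rw [mul_conj_eq, h.2 _ (conj_descent_mem_parab cs h.1 hi)]
      exact (mem_descents cs).1 hi
  refine ⟨habove, fun s hs => ?_⟩
  by_contra! hne
  have hus := mul_simple_mem_above cs habove hs fun i hi => (hne i hi).symm
  obtain ⟨v', h'⟩ := exists_isProj cs hx (u * cs.simple s)
  obtain rfl := h'.eq_of_mem_above cs hx h.1 hus
  have hr := hu.2 s hs
  have h₁ := (mem_descents cs).1 hs
  rw [h.mem_iff cs hr, ← h'.mem_iff cs hr, mem_invSet_mul_simple_of_descent cs hs] at h₁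
  exact h₁.2 rfl

theorem IsCore.mem_interval (hx : RightMin cs J x) {u v : W} (hv : v ∈ parab cs J)
    (h : IsCore cs (x * v) (descents cs v) u) : u ∈ Interval cs x J := by
  refine ⟨fun t ht => ?_, fun s hs => ?_⟩
  · exact ((hx.mem_invSet_mul cs hv).1 (h.1.1 ht)).imp_right (mem_parab_of_mem_invSet cs hv)
  · obtain ⟨i, hi, heq⟩ := h.2 s hs
    rw [heq]
    convert conj_descent_mem_parab cs hv hi using 1
    group

theorem exists_mem_interval_isProj (hx : RightMin cs J x) {v : W} (hv : v ∈ parab cs J) :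
    ∃ u ∈ Interval cs x J, IsProj cs x J u v := by
  obtain ⟨u, hu⟩ := exists_isCore cs (hx.mul_descents cs hv)
  obtain ⟨v', h'⟩ := exists_isProj cs hx u
  obtain rfl := h'.eq_of_mem_above cs hx hv hu.1
  exact ⟨u, hu.mem_interval cs hx hv, h'⟩

theorem eq_of_isProj (hx : RightMin cs J x) {u u' v : W} (hu : u ∈ Interval cs x J)
    (hu' : u' ∈ Interval cs x J) (h : IsProj cs x J u v) (h' : IsProj cs x J u' v) : u = u' :=
  (h.isCore cs hx hu).unique cs (hx.mul_descents cs h.1) (h'.isCore cs hx hu')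

theorem mem_descConj {w g : W} : g ∈ descConj cs w ↔ w⁻¹ * g * w ∈ parab cs (descents cs w) := by
  have : descConj cs w = (parab cs (descents cs w)).map (MulAut.conj w).toMonoidHom := by
    rw [parab, MonoidHom.map_closure, descConj]
    congr 1
    ext g
    simp [descents, eq_comm]
  rw [this, Subgroup.mem_map_equiv, MulAut.conj_symm_apply]

theorem descConj_le_parab {v : W} (hv : v ∈ parab cs J) : descConj cs v ≤ parab cs J := by
  rw [descConj, Subgroup.closure_le]
  rintro _ ⟨i, hi, rfl⟩
  exact conj_descent_mem_parab cs hv hi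

theorem conj_mem_descConj {w : W} {i : B} (hi : i ∈ descents cs w) :
    w * cs.simple i * w⁻¹ ∈ descConj cs w :=
  Subgroup.subset_closure ⟨i, hi, rfl⟩

theorem IsProj.mem_descConj_iff [Finite W] (hx : RightMin cs J x) {u v g : W}
    (hu : u ∈ Interval cs x J) (h : IsProj cs x J u v) :
    g ∈ descConj cs u ↔ x⁻¹ * g * x ∈ descConj cs v := by
  have hcore := h.isCore cs hx hu
  have : descConj cs u = (descConj cs v).map (MulAut.conj x).toMonoidHom := by
    apply le_antisymm
    · rw [descConj, Subgroup.closure_le]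
      rintro _ ⟨s, hs, rfl⟩
      obtain ⟨i, hi, heq⟩ := hcore.2 s hs
      rw [heq, mul_conj_eq]
      exact ⟨_, conj_mem_descConj cs hi, rfl⟩
    · rw [Subgroup.map_le_iff_le_comap, descConj, Subgroup.closure_le]
      rintro _ ⟨i, hi, rfl⟩
      obtain ⟨s, hs, heq⟩ := hcore.exists_descent cs (hx.mul_descents cs h.1) hi
      rw [mul_conj_eq] at heq
      have := conj_mem_descConj cs hs
      rw [heq] at this
      exact this
  rw [this, Subgroup.mem_map_equiv, MulAut.conj_symm_apply]

theorem shardLE.mem_interval {u w : W} (h : shardLE cs u w) (hw : w ∈ Interval cs x J) :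
    u ∈ Interval cs x J := by
  refine ⟨fun t ht => hw.1 t (h.1 ht), fun i hi => ?_⟩
  have hle : descConj cs w ≤ (parab cs J).comap (MulAut.conj x⁻¹).toMonoidHom := by
    rw [descConj, Subgroup.closure_le]
    rintro _ ⟨j, hj, rfl⟩
    simpa using hw.2 j hj
  simpa using hle (h.2 (conj_mem_descConj cs hi))

section Finite

variable [Finite W]

/-- The minimal representative of the coset of `w` modulo its right descents. -/
noncomputable def base (w : W) : W := w * (longest cs (descents cs w))⁻¹

theorem rightMin_base (w : W) : RightMin cs (descents cs w) (base cs w) :=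
  rightMin_mul_longest_inv cs subset_rfl

theorem mem_descConj_iff_base {w g : W} :
    g ∈ descConj cs w ↔ (base cs w)⁻¹ * g * base cs w ∈ parab cs (descents cs w) := by
  have hp := longest_mem cs (descents cs w)
  have e : (base cs w)⁻¹ * g * base cs w = longest cs (descents cs w) * (w⁻¹ * g * w) *
      (longest cs (descents cs w))⁻¹ := by
    rw [base]; group
  rw [mem_descConj, e, Subgroup.mul_mem_cancel_right _ (inv_mem hp),
    Subgroup.mul_mem_cancel_left _ hp]

theorem mem_invSet_iff_base {w t : W} : t ∈ invSet cs w ↔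
    t ∈ invSet cs (base cs w) ∨ (t ∈ descConj cs w ∧ cs.IsReflection t) := by
  have h := (rightMin_base cs w).mem_invSet_mul cs (t := t) (longest_mem cs _)
  rw [mem_invSet_longest, ← mem_descConj_iff_base, isReflection_conj'] at h
  rw [← h, base, inv_mul_cancel_right]

theorem shardLE_iff_mem_interval {u w : W} :
    shardLE cs u w ↔ u ∈ Interval cs (base cs w) (descents cs w) := by
  rw [shardLE, descConj, Subgroup.closure_le]
  refine and_congr ⟨fun h t ht => ?_, fun h t ht => ?_⟩ ⟨fun h i hi => ?_, ?_⟩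
  · rw [← mem_descConj_iff_base]
    exact ((mem_invSet_iff_base cs).1 (h ht)).imp_right And.left
  · rw [mem_invSet_iff_base]
    exact (h t ht).imp_right fun h => ⟨(mem_descConj_iff_base cs).2 h, ht.1⟩
  · rw [← mem_descConj_iff_base]
    exact h ⟨i, hi, rfl⟩
  · rintro h _ ⟨i, hi, rfl⟩
    exact (mem_descConj_iff_base cs).2 (h i hi)

theorem exists_shardLE_inter_eq (w u : W) :
    ∃ b, shardLE cs b w ∧ ∀ g ∈ descConj cs w, g ∈ invSet cs b ↔ g ∈ invSet cs u := by
  obtain ⟨v, hv⟩ := exists_isProj cs (rightMin_base cs w) u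
  obtain ⟨b, hb, hbv⟩ := exists_mem_interval_isProj cs (rightMin_base cs w) hv.1
  refine ⟨b, (shardLE_iff_mem_interval cs).2 hb, fun g hg => ?_⟩
  rw [mem_descConj_iff_base] at hg
  rw [hbv.mem_iff cs hg, hv.mem_iff cs hg]

theorem eq_of_shardLE_of_inter_eq {u u' w : W} (hu : shardLE cs u w) (hu' : shardLE cs u' w)
    (h : ∀ g ∈ descConj cs w, g ∈ invSet cs u ↔ g ∈ invSet cs u') : u = u' := by
  rw [shardLE_iff_mem_interval] at hu hu'
  obtain ⟨v, hv⟩ := exists_isProj cs (rightMin_base cs w) u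
  refine eq_of_isProj cs (rightMin_base cs w) hu hu' hv ⟨hv.1, fun t ht => ?_⟩
  rw [← hv.2 t ht, h]
  rw [mem_descConj_iff_base]
  convert ht using 1
  group

theorem shardLE_of_isProj (hx : RightMin cs J x) {u₁ u₂ v₁ v₂ : W} (hu₁ : u₁ ∈ Interval cs x J)
    (hu₂ : u₂ ∈ Interval cs x J) (h₁ : IsProj cs x J u₁ v₁) (h₂ : IsProj cs x J u₂ v₂)
    (h : shardLE cs u₁ u₂) : shardLE cs v₁ v₂ := by
  refine ⟨fun t ht => ?_, fun g hg => ?_⟩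
  · have htJ := mem_parab_of_mem_invSet cs h₁.1 ht
    rw [← h₁.2 t htJ] at ht
    exact (h₂.2 t htJ).1 (h.1 ht)
  · have e : x⁻¹ * (x * g * x⁻¹) * x = g := by group
    rw [← e, ← h₁.mem_descConj_iff cs hx hu₁] at hg
    rw [← e, ← h₂.mem_descConj_iff cs hx hu₂]
    exact h.2 hg

theorem shardLE_iff_isProj (hx : RightMin cs J x) {u₁ u₂ v₁ v₂ : W} (hu₁ : u₁ ∈ Interval cs x J)
    (hu₂ : u₂ ∈ Interval cs x J) (h₁ : IsProj cs x J u₁ v₁) (h₂ : IsProj cs x J u₂ v₂) :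
    shardLE cs u₁ u₂ ↔ shardLE cs v₁ v₂ := by
  refine ⟨shardLE_of_isProj cs hx hu₁ hu₂ h₁ h₂, fun h => ?_⟩
  obtain ⟨b, hb, hbu⟩ := exists_shardLE_inter_eq cs u₂ u₁
  have hbI := hb.mem_interval cs hu₂
  obtain ⟨v, hv⟩ := exists_isProj cs hx b
  obtain rfl : v = v₁ := by
    refine eq_of_shardLE_of_inter_eq cs (shardLE_of_isProj cs hx hbI hu₂ hv h₂ hb) h
      fun g hg => ?_
    have hgJ := descConj_le_parab cs h₂.1 hg
    rw [← hv.2 g hgJ, ← h₁.2 g hgJ]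
    refine hbu _ ((h₂.mem_descConj_iff cs hx hu₂).2 ?_)
    rwa [show x⁻¹ * (x * g * x⁻¹) * x = g by group]
  rwa [eq_of_isProj cs hx hu₁ hbI h₁ hv]

/-- The shard interval below `w` is isomorphic to the shard order on `W_{D_R(w)}`. -/
theorem exists_equiv_shardLE (w : W) :
    ∃ e : {u // shardLE cs u w} ≃ {v // v ∈ parab cs (descents cs w)},
      ∀ a b, shardLE cs (e a).1 (e b).1 ↔ shardLE cs a.1 b.1 := by
  have hx := rightMin_base cs w
  choose f hf using exists_isProj cs hx
  refine ⟨Equiv.ofBijective (fun u => ⟨f u.1, (hf u.1).1⟩) ⟨fun a b hab => ?_, fun v => ?_⟩,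
    fun a b => (shardLE_iff_isProj cs hx ((shardLE_iff_mem_interval cs).1 a.2)
      ((shardLE_iff_mem_interval cs).1 b.2) (hf a) (hf b)).symm⟩
  · have hab : f a.1 = f b.1 := congrArg Subtype.val hab
    have ha := hf a.1
    rw [hab] at ha
    exact Subtype.ext (eq_of_isProj cs hx ((shardLE_iff_mem_interval cs).1 a.2)
      ((shardLE_iff_mem_interval cs).1 b.2) ha (hf b.1))
  · obtain ⟨u, hu, huv⟩ := exists_mem_interval_isProj cs hx v.2
    exact ⟨⟨u, (shardLE_iff_mem_interval cs).2 hu⟩, Subtype.ext ((hf u).unique cs huv)⟩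

end Finite

/-! ### The BHZ order -/

theorem bhzLE_iff {u v : W} : bhzLE cs u v ↔ RightMin cs (supp cs u) (v * u⁻¹) := by
  refine ⟨fun h => (isMinRep_iff_rightMin cs).1 h.2.1, fun h =>
    ⟨mem_parab_supp cs u, (isMinRep_iff_rightMin cs).2 h, ?_⟩⟩
  have := h.length_mul cs (mem_parab_supp cs u)
  rwa [inv_mul_cancel_right] at this

theorem bhzLE_refl (u : W) : bhzLE cs u u := by
  rw [bhzLE_iff, mul_inv_cancel, RightMin, inv_one]
  exact fun t _ => notMem_invSet_one cs t

theorem bhzLE_trans {u v w : W} (huv : bhzLE cs u v) (hvw : bhzLE cs v w) : bhzLE cs u w := by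
  have hsub : supp cs u ⊆ supp cs v := by
    have := supp_mul cs (a := v * u⁻¹) (b := u) (by rw [inv_mul_cancel_right]; exact huv.2.2)
    rw [inv_mul_cancel_right] at this
    rw [this]
    exact Set.subset_union_right
  rw [bhzLE_iff] at huv hvw ⊢
  intro t ht hmem
  have hb : v * u⁻¹ ∈ parab cs (supp cs v) :=
    mul_mem (mem_parab_supp cs v) (inv_mem (parab_mono cs hsub (mem_parab_supp cs u)))
  have e : w * u⁻¹ = w * v⁻¹ * (v * u⁻¹) := by group
  rw [mem_invSet_inv, e, mul_conj_eq, hvw.conj_mem_invSet_mul cs hb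
    (mul_mem (mul_mem hb (parab_mono cs hsub ht)) (inv_mem hb))] at hmem
  exact huv.notMem cs ht hmem

theorem shardLE_refl (u : W) : shardLE cs u u := ⟨subset_rfl, le_rfl⟩

theorem shardLE_trans {u v w : W} (huv : shardLE cs u v) (hvw : shardLE cs v w) :
    shardLE cs u w :=
  ⟨huv.1.trans hvw.1, huv.2.trans hvw.2⟩

theorem supp_mul_of_rightMin {a p : W} (ha : RightMin cs (supp cs p) a) :
    supp cs (a * p) = supp cs a ∪ supp cs p :=
  supp_mul cs (ha.length_mul cs (mem_parab_supp cs p))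

/-- Elements having the support of `u` among their descents correspond to the elements
above `u` in the BHZ order, with the same supports. -/
theorem exists_equiv_bhzLE [Finite W] (u : W) :
    ∃ e : {w // supp cs u ⊆ descents cs w} ≃ {w // bhzLE cs u w},
      ∀ w, supp cs (e w).1 = supp cs w.1 := by
  set p := longest cs (supp cs u) with hp
  have hsupp : supp cs p = supp cs u := supp_longest cs (saturated_supp cs u)
  have hmin : ∀ w : {w // supp cs u ⊆ descents cs w}, RightMin cs (supp cs u) (w.1 * p⁻¹) :=
    fun w => rightMin_mul_longest_inv cs w.2
  refine ⟨⟨fun w => ⟨w.1 * p⁻¹ * u, ?_⟩, fun w => ⟨w.1 * u⁻¹ * p, ?_⟩, fun w => ?_, fun w => ?_⟩,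
    fun w => ?_⟩
  · rw [bhzLE_iff, mul_inv_cancel_right]
    exact hmin w
  · exact (subset_descents_longest cs _).trans
      (((bhzLE_iff cs).1 w.2).mul_descents cs (longest_mem cs _))
  · simp
  · simp
  · have h₁ := supp_mul_of_rightMin cs (hmin w)
    have h₂ := supp_mul_of_rightMin cs (p := p) (by rw [hsupp]; exact hmin w)
    rw [inv_mul_cancel_right, hsupp] at h₂
    exact h₁.trans h₂.symm

/-! ### Chains -/

/-- The `(n + 1)`-chains for the relation `r`. -/
def Chain {α : Type*} (r : α → α → Prop) (n : ℕ) : Type _ :=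
  {c : Fin (n + 1) → α // ∀ i j, i ≤ j → r (c i) (c j)}

/-- The top element of a chain. -/
def Chain.top {α : Type*} {r : α → α → Prop} {n : ℕ} (c : Chain r n) : α := c.1 (Fin.last n)

theorem Chain.le_top {α : Type*} {r : α → α → Prop} {n : ℕ} (c : Chain r n) (i : Fin (n + 1)) :
    r (c.1 i) c.top :=
  c.2 _ _ (Fin.le_last i)

/-- A chain with at least two elements is its top element together with a chain below it. -/
def chainSuccEquiv {α : Type*} {r : α → α → Prop} (hr : ∀ a, r a a)
    (ht : ∀ a b c, r a b → r b c → r a c) (n : ℕ) :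
    Chain r (n + 1) ≃ Σ w, {c : Chain r n // r c.top w} where
  toFun c := ⟨c.top, ⟨fun i => c.1 i.castSucc, fun _ _ h => c.2 _ _ h⟩, c.le_top _⟩
  invFun p := ⟨Fin.snoc (α := fun _ => α) p.2.1.1 p.1, fun i j hij => by
    induction j using Fin.lastCases with
    | last =>
      induction i using Fin.lastCases with
      | last => exact hr _
      | cast i =>
        rw [Fin.snoc_castSucc, Fin.snoc_last]
        exact ht _ _ _ (p.2.1.le_top i) p.2.2
    | cast j =>
      induction i using Fin.lastCases with
      | last => exact absurd (Fin.castSucc_lt_last j) hij.not_gt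
      | cast i =>
        rw [Fin.snoc_castSucc, Fin.snoc_castSucc]
        exact p.2.1.2 _ _ hij⟩
  left_inv c := Subtype.ext (Fin.snoc_init_self (α := fun _ => α) c.1)
  right_inv p := Sigma.subtype_ext (Fin.snoc_last (α := fun _ => α) _ _)
    (Subtype.ext (Fin.init_snoc (α := fun _ => α) _ _))

/-- Exchanging the order of the two components of a dependent pair cut out by `P`. -/
def sigmaSubtypeComm {α β : Type*} (P : α → β → Prop) :
    (Σ a, {b // P a b}) ≃ Σ b, {a // P a b} where
  toFun p := ⟨p.2.1, p.1, p.2.2⟩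
  invFun p := ⟨p.2.1, p.1, p.2.2⟩
  left_inv _ := rfl
  right_inv _ := rfl

/-- Shard chains below `w` correspond to shard chains in `W_{D_R(w)}`. -/
theorem nonempty_chain_shardLE_equiv [Finite W] (w : W) (n : ℕ) :
    Nonempty ({c : Chain (shardLE cs) n // shardLE cs c.top w} ≃
      {c : Chain (shardLE cs) n // supp cs c.top ⊆ descents cs w}) := by
  obtain ⟨e, he⟩ := exists_equiv_shardLE cs w
  have he' : ∀ a b, shardLE cs (e.symm a).1 (e.symm b).1 ↔ shardLE cs a.1 b.1 := fun a b => by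
    rw [← he, e.apply_symm_apply, e.apply_symm_apply]
  have hle : ∀ c : {c : Chain (shardLE cs) n // shardLE cs c.top w}, ∀ i,
      shardLE cs (c.1.1 i) w := fun c i => shardLE_trans cs (c.1.le_top i) c.2
  have hmem : ∀ c : {c : Chain (shardLE cs) n // supp cs c.top ⊆ descents cs w}, ∀ i,
      c.1.1 i ∈ parab cs (descents cs w) := fun c i => by
    have htop := ((saturated_descents cs w).mem_parab_iff cs).2 c.2
    exact mem_parab_of_invSet_subset cs fun t ht =>
      mem_parab_of_mem_invSet cs htop ((c.1.le_top i).1 ht)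
  refine ⟨⟨fun c => ⟨⟨fun i => (e ⟨c.1.1 i, hle c i⟩).1, fun i j hij => (he _ _).2 (c.1.2 i j hij)⟩,
    ((saturated_descents cs w).mem_parab_iff cs).1 (e _).2⟩,
    fun c => ⟨⟨fun i => (e.symm ⟨c.1.1 i, hmem c i⟩).1, fun i j hij => (he' _ _).2 (c.1.2 i j hij)⟩,
      (e.symm _).2⟩, fun c => ?_, fun c => ?_⟩⟩
  · refine Subtype.ext (Subtype.ext (funext fun i => ?_))
    simp
  · refine Subtype.ext (Subtype.ext (funext fun i => ?_))
    simp

theorem exists_chain_equiv [Finite W] (n : ℕ) :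
    ∃ e : Chain (shardLE cs) n ≃ Chain (bhzLE cs) n, ∀ c, supp cs (e c).top = supp cs c.top := by
  induction n with
  | zero =>
    have hall : ∀ (r : W → W → Prop), (∀ a, r a a) → ∀ (c : Fin 1 → W) i j, i ≤ j → r (c i) (c j) :=
      fun r hr c i j _ => Subsingleton.elim i j ▸ hr _
    exact ⟨Equiv.subtypeEquivRight fun c => iff_of_true (hall _ (shardLE_refl cs) c)
      (hall _ (bhzLE_refl cs) c), fun c => rfl⟩
  | succ n ih =>
    obtain ⟨e, he⟩ := ih
    choose f hf using exists_equiv_bhzLE cs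
    let e₁ := chainSuccEquiv (shardLE_refl cs) (fun _ _ _ => shardLE_trans cs) n
    let e₂ := Equiv.sigmaCongrRight fun w => (nonempty_chain_shardLE_equiv cs w n).some
    let e₃ := Equiv.sigmaCongrRight fun w => e.subtypeEquiv
      (p := fun c => supp cs c.top ⊆ descents cs w) (q := fun c => supp cs c.top ⊆ descents cs w)
      fun c => by rw [he]
    let e₄ := sigmaSubtypeComm fun w (c : Chain (bhzLE cs) n) => supp cs c.top ⊆ descents cs w
    let e₅ := Equiv.sigmaCongrRight fun c : Chain (bhzLE cs) n => f c.top
    let e₆ := sigmaSubtypeComm fun w (c : Chain (bhzLE cs) n) => bhzLE cs c.top w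
    let e₇ := chainSuccEquiv (bhzLE_refl cs) (fun _ _ _ => bhzLE_trans cs) n
    refine ⟨e₁.trans <| e₂.trans <| e₃.trans <| e₄.trans <| e₅.trans <| e₆.symm.trans e₇.symm,
      fun c => ?_⟩
    have h₇ : ∀ p, (e₇.symm p).top = p.1 := fun p => congrArg Sigma.fst (e₇.apply_symm_apply p)
    simp only [Equiv.trans_apply]
    rw [h₇]
    exact hf _ _

/-- **Theorem (main).** For every subset `J` of the simple reflections and every `k ≥ 1`,
the number of `k`-chains whose top element has support `J` is the same for the shard
order and the BHZ order. -/
theorem chains_top_supp_card_eq [Finite W] (J : Set B) (k : ℕ) (hk : 1 ≤ k) :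
    Nat.card {c : Fin k → W // (∀ i j : Fin k, i ≤ j → shardLE cs (c i) (c j)) ∧
        supp cs (c ⟨k - 1, by omega⟩) = J} =
      Nat.card {c : Fin k → W // (∀ i j : Fin k, i ≤ j → bhzLE cs (c i) (c j)) ∧
        supp cs (c ⟨k - 1, by omega⟩) = J} := by
  obtain ⟨n, rfl⟩ := Nat.exists_eq_add_of_le' hk
  obtain ⟨e, he⟩ := exists_chain_equiv cs n
  refine Nat.card_congr ((Equiv.subtypeSubtypeEquivSubtypeInter _ _).symm.trans
    (Equiv.trans ?_ (Equiv.subtypeSubtypeEquivSubtypeInter _ _)))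
  exact e.subtypeEquiv (p := fun c => supp cs c.top = J) (q := fun c => supp cs c.top = J)
    fun c => by rw [he]

end ShardBHZ
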